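/- Fix q > 1 and assume the standing convergence conditions (C2), (C3), (C4) hold for (b_n, c_n, ν_n) and (b, c, ν). Assume I_n(q) = ∫_{x≥1} e^{qx/(q−1)} dν_n(x) < ∞ for every n and I_n(q) → +∞. Then for every u > 0, F^n(u) → +∞ as n → ∞. -/

import Mathlib

open MeasureTheory Filter Set
open scoped ENNReal

/-- The truncation function `h(x) = x · 1_{|x| ≤ 1}`. -/
noncomputable def htrunc (x : ℝ) : ℝ := if |x| ≤ 1 then x else 0

/-- `Y_u(x) = (1 + (q-1)u(eˣ-1))^{1/(q-1)}` if `1 + (q-1)u(eˣ-1) ≥ 0`, else `0`. -/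
noncomputable def Yq (q u x : ℝ) : ℝ :=
  if 0 ≤ 1 + (q - 1) * u * (Real.exp x - 1) then
    (1 + (q - 1) * u * (Real.exp x - 1)) ^ (1 / (q - 1))
  else 0

/-- `F(u) = b + c/2 + c·u + ∫ ((eˣ-1)Y_u(x) - h(x)) dν(x)`. -/
noncomputable def Fq (q b c : ℝ) (ν : Measure ℝ) (u : ℝ) : ℝ :=
  b + c / 2 + c * u + ∫ x, ((Real.exp x - 1) * Yq q u x - htrunc x) ∂ν

lemma Yq_nonneg (q u x : ℝ) : 0 ≤ Yq q u x := by
  unfold Yq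
  split_ifs with h
  · exact Real.rpow_nonneg h _
  · exact le_rfl

lemma one_le_Yq {q u x : ℝ} (hq : 1 < q) (hu : 0 ≤ u) (hx : 0 ≤ x) : 1 ≤ Yq q u x := by
  have hp : 0 ≤ 1 / (q - 1) := one_div_nonneg.mpr (by linarith)
  have he : 0 ≤ Real.exp x - 1 := by linarith [Real.add_one_le_exp x]
  have ht : 0 ≤ (q - 1) * u * (Real.exp x - 1) :=
    mul_nonneg (mul_nonneg (by linarith) hu) he
  rw [Yq, if_pos (by linarith)]
  exact Real.one_le_rpow (by linarith) hp

lemma Yq_le_one {q u x : ℝ} (hq : 1 < q) (hu : 0 ≤ u) (hx : x ≤ 0) : Yq q u x ≤ 1 := by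
  have hp : 0 ≤ 1 / (q - 1) := one_div_nonneg.mpr (by linarith)
  have he : 0 ≤ 1 - Real.exp x := by linarith [Real.exp_le_one_iff.mpr hx]
  have ht : 0 ≤ (q - 1) * u * (1 - Real.exp x) :=
    mul_nonneg (mul_nonneg (by linarith) hu) he
  unfold Yq
  split_ifs with h
  · exact Real.rpow_le_one h (by linarith) hp
  · exact zero_le_one

lemma measurable_htrunc : Measurable htrunc :=
  Measurable.ite (measurableSet_le (by fun_prop) measurable_const) measurable_id measurable_const

lemma measurable_Yq (q u : ℝ) : Measurable (Yq q u) :=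
  Measurable.ite (measurableSet_le measurable_const (by fun_prop)) (by fun_prop) measurable_const

lemma htrunc_nonneg {x : ℝ} (hx : 0 ≤ x) : 0 ≤ htrunc x := by
  unfold htrunc; split_ifs <;> linarith

lemma htrunc_le_one (x : ℝ) : htrunc x ≤ 1 := by
  unfold htrunc
  split_ifs with h
  · exact (abs_le.mp h).2
  · exact zero_le_one

lemma htrunc_le_self {x : ℝ} (hx : 0 ≤ x) : htrunc x ≤ x := by
  unfold htrunc; split_ifs <;> linarith

/-- The integrand of `Fq` is nonnegative on `[-1, ∞)`. -/
lemma integrand_nonneg {q u x : ℝ} (hq : 1 < q) (hu : 0 ≤ u) (hx : -1 ≤ x) :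
    0 ≤ (Real.exp x - 1) * Yq q u x - htrunc x := by
  have he := Real.add_one_le_exp x
  rcases le_total 0 x with h | h
  · have := htrunc_le_self h
    nlinarith [one_le_Yq hq hu h]
  · have hh : htrunc x = x := if_pos (abs_le.mpr ⟨hx, by linarith⟩)
    have := Real.exp_le_one_iff.mpr h
    nlinarith [Yq_le_one hq hu h]

/-- Left of `-1`, the integrand of `Fq` takes values in `[-1, 0]`. -/
lemma integrand_mem_Icc {q u x : ℝ} (hq : 1 < q) (hu : 0 ≤ u) (hx : x < -1) :
    (Real.exp x - 1) * Yq q u x - htrunc x ∈ Icc (-1) 0 := by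
  have hh : htrunc x = 0 := if_neg (by rw [abs_of_neg (by linarith)]; linarith)
  have h1 := Real.exp_le_one_iff.mpr (show x ≤ 0 by linarith)
  have h0 := Real.exp_pos x
  have hY := Yq_le_one hq hu (show x ≤ 0 by linarith)
  have hY0 := Yq_nonneg q u x
  rw [hh]
  constructor <;> nlinarith

lemma two_lt_exp_one : 2 < Real.exp 1 := by linarith [Real.exp_one_gt_d9]

lemma exp_mul_rpow {q x : ℝ} (hq : 1 < q) :
    Real.exp x * Real.exp x ^ (1 / (q - 1)) = Real.exp (q * x / (q - 1)) := by
  have : q - 1 ≠ 0 := by linarith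
  rw [← Real.exp_mul, ← Real.exp_add]
  congr 1
  field_simp
  ring

/-- On `[1, ∞)`, the integrand of `Fq` dominates a multiple of `e^{qx/(q-1)}`. -/
lemma exists_le_integrand {q u : ℝ} (hq : 1 < q) (hu : 0 < u) :
    ∃ κ : ℝ, 0 < κ ∧ ∀ x, 1 ≤ x →
      κ * Real.exp (q * x / (q - 1)) ≤ (Real.exp x - 1) * Yq q u x - htrunc x := by
  have hq1 : 0 < q - 1 := by linarith
  have ha : 0 < (q - 1) * u / 2 := by positivity
  have hp : 0 ≤ 1 / (q - 1) := one_div_nonneg.mpr hq1.le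
  have he1 := two_lt_exp_one
  have hκ : 0 < 1 - 2 / Real.exp 1 := by
    rw [sub_pos, div_lt_one (Real.exp_pos 1)]; exact he1
  refine ⟨(1 - 2 / Real.exp 1) * ((q - 1) * u / 2) ^ (1 / (q - 1)), by positivity, fun x hx => ?_⟩
  have hex : Real.exp 1 ≤ Real.exp x := Real.exp_le_exp.mpr hx
  have hY1 := one_le_Yq hq hu.le (show 0 ≤ x by linarith)
  have hY : ((q - 1) * u / 2) ^ (1 / (q - 1)) * Real.exp x ^ (1 / (q - 1)) ≤ Yq q u x := by
    have hmul : 0 < (q - 1) * u := by positivity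
    have : (q - 1) * u / 2 * Real.exp x ≤ 1 + (q - 1) * u * (Real.exp x - 1) := by nlinarith
    rw [← Real.mul_rpow ha.le (Real.exp_pos x).le, Yq, if_pos (le_trans (by positivity) this)]
    exact Real.rpow_le_rpow (by positivity) this hp
  have hE : (1 - 2 / Real.exp 1) * Real.exp x ≤ Real.exp x - 2 := by
    have : 2 ≤ 2 / Real.exp 1 * Real.exp x := by
      rw [div_mul_eq_mul_div, le_div_iff₀ (Real.exp_pos 1)]; linarith
    linarith
  calc _ = ((1 - 2 / Real.exp 1) * Real.exp x) *
        (((q - 1) * u / 2) ^ (1 / (q - 1)) * Real.exp x ^ (1 / (q - 1))) := by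
        rw [← exp_mul_rpow hq]; ring
    _ ≤ (Real.exp x - 2) * Yq q u x :=
        mul_le_mul hE hY (by positivity) (by linarith)
    _ ≤ _ := by linarith [htrunc_le_one x]

/-- On `[1, ∞)`, the integrand of `Fq` is at most a multiple of `e^{qx/(q-1)}`. -/
lemma integrand_le_exp {q u x : ℝ} (hq : 1 < q) (hu : 0 ≤ u) (hx : 1 ≤ x) :
    (Real.exp x - 1) * Yq q u x - htrunc x ≤
      (1 + (q - 1) * u) ^ (1 / (q - 1)) * Real.exp (q * x / (q - 1)) := by
  have hq1 : 0 < q - 1 := by linarith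
  have hp : 0 ≤ 1 / (q - 1) := one_div_nonneg.mpr hq1.le
  have ha : 0 ≤ (q - 1) * u := by positivity
  have he := Real.add_one_le_exp x
  have hY : Yq q u x ≤ (1 + (q - 1) * u) ^ (1 / (q - 1)) * Real.exp x ^ (1 / (q - 1)) := by
    have h0 : 0 ≤ 1 + (q - 1) * u * (Real.exp x - 1) := by nlinarith
    rw [← Real.mul_rpow (by linarith) (Real.exp_pos x).le, Yq, if_pos h0]
    exact Real.rpow_le_rpow h0 (by nlinarith) hp
  calc _ ≤ Real.exp x * Yq q u x := by
        linarith [htrunc_nonneg (show 0 ≤ x by linarith), Yq_nonneg q u x]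
    _ ≤ Real.exp x * ((1 + (q - 1) * u) ^ (1 / (q - 1)) * Real.exp x ^ (1 / (q - 1))) := by
        gcongr
    _ = _ := by rw [← exp_mul_rpow hq]; ring

/-- `Y_u` is Lipschitz at `0`, on `[-1, 1]`. -/
lemma exists_abs_Yq_sub_one_le {q u : ℝ} (hq : 1 < q) (hu : 0 ≤ u) :
    ∃ K : ℝ, 0 ≤ K ∧ ∀ x, |x| ≤ 1 → |Yq q u x - 1| ≤ K * |x| := by
  have hq1 : 0 < q - 1 := by linarith
  set p := 1 / (q - 1) with hpdef
  have hp : 0 < p := one_div_pos.mpr hq1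
  have ha : 0 ≤ (q - 1) * u := by positivity
  set a := (q - 1) * u with hadef
  obtain ⟨n, hn⟩ := exists_nat_ge (max p 1)
  have hnp : p ≤ n := (le_max_left _ _).trans hn
  have hn1 : (1 : ℝ) ≤ n := (le_max_right _ _).trans hn
  refine ⟨2 * a * (n * Real.exp (p * (2 * a))), by positivity, fun x hx => ?_⟩
  have hex : |Real.exp x - 1| ≤ 2 * |x| := Real.abs_exp_sub_one_le hx
  have hE1 : 1 ≤ Real.exp (p * (2 * a)) := Real.one_le_exp (by positivity)
  rcases le_total 0 x with h | h
  · have h1 := one_le_Yq hq hu h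
    have he := Real.add_one_le_exp x
    rw [abs_of_nonneg h, abs_of_nonneg (by linarith)] at hex
    rw [abs_of_nonneg h] at hx
    rw [abs_of_nonneg (by linarith), abs_of_nonneg h]
    set t := a * (Real.exp x - 1) with ht
    have ht0 : 0 ≤ t := mul_nonneg ha (by linarith)
    have htx : t ≤ 2 * a * x := by nlinarith
    have hta : t ≤ 2 * a := by nlinarith
    have hY : Yq q u x ≤ Real.exp (p * t) := by
      rw [Yq, if_pos (by linarith), mul_comm p, Real.exp_mul]
      exact Real.rpow_le_rpow (by linarith) (by linarith [Real.add_one_le_exp t]) hp.le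
    have hpt : Real.exp (p * t) - 1 ≤ p * t * Real.exp (p * t) := by
      have h2 := Real.add_one_le_exp (-(p * t))
      have h3 : Real.exp (-(p * t)) * Real.exp (p * t) = 1 := by
        rw [← Real.exp_add]; simp
      nlinarith [Real.exp_pos (p * t)]
    calc Yq q u x - 1 ≤ p * t * Real.exp (p * t) := by linarith
      _ ≤ n * (2 * a * x) * Real.exp (p * (2 * a)) := by gcongr
      _ = _ := by ring
  · have h1 := Yq_le_one hq hu h
    have he := Real.exp_le_one_iff.mpr h
    rw [abs_of_nonpos h, abs_of_nonpos (by linarith)] at hex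
    rw [abs_of_nonpos (by linarith), abs_of_nonpos h]
    set s := a * (1 - Real.exp x) with hs
    have hs0 : 0 ≤ s := mul_nonneg ha (by linarith)
    have hsx : s ≤ 2 * a * (-x) := by nlinarith
    have hts : 1 + a * (Real.exp x - 1) = 1 - s := by rw [hs]; ring
    have hY : 1 - n * s ≤ Yq q u x := by
      rw [Yq, ← hadef, hts]
      split_ifs with h0
      · have hB := one_add_mul_le_pow (a := -s) (by linarith) n
        have hr : (1 - s) ^ (n : ℝ) ≤ (1 - s) ^ p := by
          rcases h0.eq_or_lt with h4 | h4
          · rw [← h4, Real.zero_rpow (by linarith), Real.zero_rpow hp.ne']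
          · exact Real.rpow_le_rpow_of_exponent_ge h4 (by linarith) hnp
        rw [Real.rpow_natCast] at hr
        rw [show 1 + -s = 1 - s by ring] at hB
        linarith
      · nlinarith
    have hnx : 0 ≤ n * (2 * a * (-x)) := by
      have : 0 ≤ -x := by linarith
      positivity
    calc -(Yq q u x - 1) ≤ n * s * 1 := by linarith
      _ ≤ n * (2 * a * (-x)) * Real.exp (p * (2 * a)) := by gcongr
      _ = _ := by ring

/-- On `[-1, 1]`, the integrand of `Fq` is `O(x²)`. -/
lemma exists_integrand_le_sq {q u : ℝ} (hq : 1 < q) (hu : 0 ≤ u) :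
    ∃ C : ℝ, 0 ≤ C ∧ ∀ x, |x| ≤ 1 →
      |(Real.exp x - 1) * Yq q u x - htrunc x| ≤ C * x ^ 2 := by
  obtain ⟨K, hK, hY⟩ := exists_abs_Yq_sub_one_le hq hu
  refine ⟨1 + 2 * K, by positivity, fun x hx => ?_⟩
  rw [htrunc, if_pos hx, show (Real.exp x - 1) * Yq q u x - x =
    (Real.exp x - 1 - x) + (Real.exp x - 1) * (Yq q u x - 1) by ring]
  calc _ ≤ |Real.exp x - 1 - x| + |(Real.exp x - 1) * (Yq q u x - 1)| := abs_add_le _ _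
    _ ≤ x ^ 2 + (2 * |x|) * (K * |x|) := by
        rw [abs_mul]
        exact add_le_add (Real.abs_exp_sub_one_sub_id_le hx)
          (mul_le_mul (Real.abs_exp_sub_one_le hx) (hY x hx) (abs_nonneg _) (by positivity))
    _ = _ := by rw [← sq_abs x]; ring

lemma integrable_min_sq_one {μ : Measure ℝ}
    (hμ : ∫⁻ x, ENNReal.ofReal (min (x ^ 2) 1) ∂μ < ⊤) :
    Integrable (fun x : ℝ => min (x ^ 2) 1) μ := by
  refine ⟨by fun_prop, ?_⟩
  rw [hasFiniteIntegral_iff_ofReal (ae_of_all _ fun x => by positivity)]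
  exact hμ

lemma integrable_indicator_exp {μ : Measure ℝ} {r : ℝ → ℝ} (hr : Measurable r) {s : Set ℝ}
    (hs : MeasurableSet s) (hμ : ∫⁻ x in s, ENNReal.ofReal (Real.exp (r x)) ∂μ < ⊤) :
    Integrable (s.indicator fun x => Real.exp (r x)) μ := by
  rw [integrable_indicator_iff hs]
  refine ⟨by fun_prop, ?_⟩
  rw [hasFiniteIntegral_iff_ofReal (ae_of_all _ fun x => (Real.exp_pos _).le)]
  exact hμ

lemma integrable_integrand {q u : ℝ} (hq : 1 < q) (hu : 0 ≤ u) {μ : Measure ℝ}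
    (hμ : ∫⁻ x, ENNReal.ofReal (min (x ^ 2) 1) ∂μ < ⊤)
    (hI : ∫⁻ x in Ici (1 : ℝ), ENNReal.ofReal (Real.exp (q * x / (q - 1))) ∂μ < ⊤) :
    Integrable (fun x => (Real.exp x - 1) * Yq q u x - htrunc x) μ := by
  obtain ⟨C, hC, hg⟩ := exists_integrand_le_sq hq hu
  have hq1 : 0 < q - 1 := by linarith
  have hmeas : Measurable (fun x => (Real.exp x - 1) * Yq q u x - htrunc x) :=
    ((Real.measurable_exp.sub_const 1).mul (measurable_Yq q u)).sub measurable_htrunc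
  refine Integrable.mono' (((integrable_min_sq_one hμ).const_mul (C + 1)).add
    ((integrable_indicator_exp (by fun_prop) measurableSet_Ici hI).const_mul
      ((1 + (q - 1) * u) ^ (1 / (q - 1))))) hmeas.aestronglyMeasurable (ae_of_all _ fun x => ?_)
  have hm : 0 ≤ min (x ^ 2) 1 := by positivity
  have hi : 0 ≤ (1 + (q - 1) * u) ^ (1 / (q - 1)) *
      (Ici (1 : ℝ)).indicator (fun x => Real.exp (q * x / (q - 1))) x :=
    mul_nonneg (by positivity) (indicator_nonneg (fun _ _ => (Real.exp_pos _).le) _)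
  simp only [Pi.add_apply, Real.norm_eq_abs]
  rcases lt_or_ge x (-1) with h | h
  · have hb := integrand_mem_Icc hq hu h
    have : min (x ^ 2) 1 = 1 := min_eq_right (by nlinarith)
    rw [abs_of_nonpos hb.2, this]
    linarith [hb.1]
  rcases lt_or_ge x 1 with h' | h'
  · have hx : |x| ≤ 1 := abs_le.mpr ⟨h, h'.le⟩
    have : min (x ^ 2) 1 = x ^ 2 := min_eq_left (by nlinarith)
    rw [this]
    linarith [hg x hx, sq_nonneg x]
  · rw [abs_of_nonneg (integrand_nonneg hq hu h), indicator_of_mem (mem_Ici.mpr h')]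
    nlinarith [integrand_le_exp hq hu h']

lemma tendsto_min_abs_cube_div_sq :
    Tendsto (fun x : ℝ => min (|x| ^ 3) 1 / x ^ 2) (nhdsWithin 0 {(0 : ℝ)}ᶜ) (nhds 0) := by
  have h0 : Tendsto (fun x : ℝ => |x|) (nhdsWithin 0 {(0 : ℝ)}ᶜ) (nhds 0) := by
    have : Tendsto (fun x : ℝ => |x|) (nhds 0) (nhds 0) := by
      simpa using (continuous_abs (G := ℝ)).tendsto 0
    exact this.mono_left nhdsWithin_le_nhds
  refine squeeze_zero' (Eventually.of_forall fun x => by positivity) ?_ h0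
  filter_upwards [self_mem_nhdsWithin] with x hx
  have hx2 : 0 < x ^ 2 := by have : x ≠ 0 := hx; positivity
  rw [div_le_iff₀ hx2, ← sq_abs x]
  exact (min_le_left _ _).trans (by ring_nf; rfl)

/-- third case of Lemma 10: under (C2), (C3), (C4) and `I_n(q) → ∞`,
for every `u > 0`, `F^n(u) → +∞`. -/
theorem stmt_17 (q b c : ℝ) (hq : 1 < q) (hc : 0 ≤ c) (ν : Measure ℝ)
    (hν0 : ν {0} = 0)
    (hν : ∫⁻ x, ENNReal.ofReal (min (x ^ 2) 1) ∂ν < ⊤)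
    (bn cn : ℕ → ℝ) (hcn : ∀ n, 0 ≤ cn n) (νn : ℕ → Measure ℝ)
    (hνn0 : ∀ n, νn n {0} = 0)
    (hνn : ∀ n, ∫⁻ x, ENNReal.ofReal (min (x ^ 2) 1) ∂(νn n) < ⊤)
    (hC2 : Tendsto bn atTop (nhds b))
    (hC3 : Tendsto (fun n => cn n + ∫ x, (htrunc x) ^ 2 ∂(νn n)) atTop
      (nhds (c + ∫ x, (htrunc x) ^ 2 ∂ν)))
    (hC4 : ∀ f : ℝ → ℝ, Continuous f → (∃ Mf : ℝ, ∀ x, |f x| ≤ Mf) →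
      Tendsto (fun x => f x / x ^ 2) (nhdsWithin 0 {(0 : ℝ)}ᶜ) (nhds 0) →
      Tendsto (fun n => ∫ x, f x ∂(νn n)) atTop (nhds (∫ x, f x ∂ν)))
    (hIn : ∀ n, ∫⁻ x in Set.Ici (1 : ℝ),
      ENNReal.ofReal (Real.exp (q * x / (q - 1))) ∂(νn n) < ⊤)
    (hIdiv : Tendsto
      (fun n => ∫⁻ x in Set.Ici (1 : ℝ),
        ENNReal.ofReal (Real.exp (q * x / (q - 1))) ∂(νn n)) atTop (nhds ⊤)) :
    ∀ u : ℝ, 0 < u →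
      Tendsto (fun n => Fq q (bn n) (cn n) (νn n) u) atTop atTop := by
  intro u hu
  obtain ⟨κ, hκ, hκle⟩ := exists_le_integrand hq hu
  have hE : ∀ n, Integrable
      ((Ici (1 : ℝ)).indicator fun x => Real.exp (q * x / (q - 1))) (νn n) :=
    fun n => integrable_indicator_exp (by fun_prop) measurableSet_Ici (hIn n)
  have hIeq : ∀ n, ∫⁻ x in Ici (1 : ℝ), ENNReal.ofReal (Real.exp (q * x / (q - 1))) ∂(νn n) =
      ENNReal.ofReal
        (∫ x, (Ici (1 : ℝ)).indicator (fun x => Real.exp (q * x / (q - 1))) x ∂(νn n)) := by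
    intro n
    rw [integral_indicator measurableSet_Ici, ofReal_integral_eq_lintegral_ofReal
      ((integrable_indicator_iff measurableSet_Ici).mp (hE n))
      (ae_of_all _ fun x => (Real.exp_pos _).le)]
  have hItop : Tendsto (fun n => ∫ x, (Ici (1 : ℝ)).indicator
      (fun x => Real.exp (q * x / (q - 1))) x ∂(νn n)) atTop atTop := by
    simp only [hIeq] at hIdiv
    exact ENNReal.tendsto_ofReal_nhds_top.mp hIdiv
  have hcube := hC4 (fun x => min (|x| ^ 3) 1) (by fun_prop)
    ⟨1, fun x => by rw [abs_of_nonneg (by positivity)]; exact min_le_right _ _⟩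
    tendsto_min_abs_cube_div_sq
  have hcubeInt : ∀ n, Integrable (fun x : ℝ => min (|x| ^ 3) 1) (νn n) := by
    intro n
    refine (integrable_min_sq_one (hνn n)).mono' (by fun_prop) (ae_of_all _ fun x => ?_)
    rw [Real.norm_eq_abs, abs_of_nonneg (by positivity)]
    rcases le_total |x| 1 with h | h
    · refine min_le_min_right _ ?_
      rw [← sq_abs x]
      exact pow_le_pow_of_le_one (abs_nonneg x) h (by norm_num)
    · rw [min_eq_right (a := x ^ 2) (by rw [← sq_abs x]; exact one_le_pow₀ h)]
      exact min_le_right _ _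
  refine tendsto_atTop_mono (fun n => ?_)
    ((hC2.sub hcube).add_atTop (hItop.const_mul_atTop hκ))
  have hint : κ * (∫ x, (Ici (1 : ℝ)).indicator (fun x => Real.exp (q * x / (q - 1))) x ∂(νn n))
      - ∫ x, min (|x| ^ 3) 1 ∂(νn n) ≤
      ∫ x, ((Real.exp x - 1) * Yq q u x - htrunc x) ∂(νn n) := by
    rw [← integral_const_mul, ← integral_sub ((hE n).const_mul κ) (hcubeInt n)]
    refine integral_mono (((hE n).const_mul κ).sub (hcubeInt n))
      (integrable_integrand hq hu.le (hνn n) (hIn n)) fun x => ?_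
    have hm : 0 ≤ min (|x| ^ 3) 1 := by positivity
    rcases le_or_gt 1 x with h | h
    · simp only [indicator_of_mem (mem_Ici.mpr h)]
      linarith [hκle x h]
    · simp only [indicator_of_notMem (notMem_Ici.mpr h)]
      rcases le_or_gt (-1) x with h' | h'
      · linarith [integrand_nonneg hq hu.le h']
      · rw [min_eq_right (one_le_pow₀ (by rw [abs_of_neg (by linarith)]; linarith))]
        linarith [(integrand_mem_Icc hq hu.le h').1]
  have hcu : 0 ≤ cn n * u := mul_nonneg (hcn n) hu.le
  have hc0 := hcn n
  unfold Fq
  linarith
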